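/- Two's complement sign-bit identity: for all natural numbers n, a, b with a < 2^n and b < 2^n, the n-th binary digit of a + (2^(n+1) − 1 − b) + 1 equals 1 if and only if a < b; in Lean terms, Nat.testBit (a + (2^(n+1) − 1 − b) + 1) n = decide (a < b). -/

import Mathlib

/-- Two's complement sign-bit identity: for `a, b < 2^n`, the `n`-th binary digit of
`a + (2^(n+1) − 1 − b) + 1` is `1` exactly when `a < b`. -/
theorem twos_complement_sign_bit (n a b : ℕ) (ha : a < 2 ^ n) (hb : b < 2 ^ n) :
    Nat.testBit (a + (2 ^ (n + 1) - 1 - b) + 1) n = decide (a < b) := by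
  rw [Nat.testBit_eq_decide_div_mod_eq, decide_eq_decide]
  have hpow : 2 ^ (n + 1) = 2 * 2 ^ n := pow_succ' 2 n
  rcases lt_or_ge a b with h | h
  · have hdiv : (a + (2 ^ (n + 1) - 1 - b) + 1) / 2 ^ n = 1 :=
      Nat.div_eq_of_lt_le (by omega) (by omega)
    simp [hdiv, h]
  · have hdiv : (a + (2 ^ (n + 1) - 1 - b) + 1) / 2 ^ n = 2 :=
      Nat.div_eq_of_lt_le (by omega) (by omega)
    simp [hdiv, h]
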